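/- The line TL' bisects angle ATL; that is, ∠ATL' = ∠L'TL. -/

import Mathlib

open EuclideanGeometry Real RealInnerProductSpace Affine

/-- The Euclidean plane. -/
abbrev Plane := EuclideanSpace ℝ (Fin 2)


lemma aj_alg (b c q w k R h d s S : ℝ) (hs : s = b * c) (hd : d = b - c) (hS : S = (b+c)^2)
    (hq : q = s - 1) (hq0 : 0 < q) (hw : 0 < w) (hk : k = 1 - w * q) (hk0 : 0 < k)
    (hR0 : 0 < R) (hR : R^2 = h^2 + S/4) (hS0 : 0 < S)
    (ht : (-d/2 - w*d)^2 + (h - (s*w+w+1))^2 = (R+k)^2) :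
    R = (S*w^2+1)/(4*w) ∧ h = (S*w^2-1)/(4*w) := by
  have hs0 : 0 < s := by linarith
  have hdS : d^2 = S - 4*s := by subst hs hd hS; ring
  have hE : 2*(w+1)*(R+h) - 2*s*w*(R-h) = S*w*(w+1) - s := by
    subst hk hq
    linear_combination -ht - hR + (w+1/2)^2 * hdS
  have hxy : (R+h)*(R-h) = S/4 := by linear_combination hR
  have hy : 0 < R - h := by nlinarith
  have hf : (2*w*(R-h) - 1) * (s*(R-h) + (w+1)*S/2) = 0 := by
    linear_combination -(R-h)*hE + 2*(w+1)*hxy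
  have h2 : s*(R-h) + (w+1)*S/2 ≠ 0 := by positivity
  have h1 : 2*w*(R-h) = 1 := by
    rcases mul_eq_zero.1 hf with h | h
    · linarith
    · exact absurd h h2
  have hx : R + h = S*w/2 := by
    linear_combination 2*w*hxy - (R+h)*h1
  constructor
  · field_simp
    linear_combination 2*w*hx + h1
  · field_simp
    linear_combination 2*w*hx - h1

lemma aj_T (b c q w k R h d s S tx ty : ℝ) (hs : s = b * c) (hd : d = b - c) (hS : S = (b+c)^2)
    (hq : q = s - 1) (hq0 : 0 < q) (hw : 0 < w) (hk : k = 1 - w * q) (hk0 : 0 < k)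
    (hR0 : 0 < R) (hR : R = (S*w^2+1)/(4*w)) (hh : h = (S*w^2-1)/(4*w))
    (htx : (R+k)*tx = k*(-d/2) + R*(w*d)) (hty : (R+k)*ty = k*h + R*(s*w+w+1)) :
    (1-k)^2*((tx-d/q)^2+(ty-2*s/q)^2) = k^2*(tx^2+ty^2) := by
  have e1 : 1 - k = w*q := by linarith
  have e2 : (1-k)^2*((tx-d/q)^2+(ty-2*s/q)^2) = w^2*((q*tx-d)^2+(q*ty-2*s)^2) := by
    rw [e1]; field_simp
  rw [e2]
  have h0 : (R+k)^2 ≠ 0 := by positivity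
  apply mul_left_cancel₀ h0
  have e3 : (R+k)^2*(w^2*((q*tx-d)^2+(q*ty-2*s)^2))
     = w^2*((q*((R+k)*tx)-(R+k)*d)^2+(q*((R+k)*ty)-(R+k)*(2*s))^2) := by ring
  have e4 : (R+k)^2*(k^2*(tx^2+ty^2)) = k^2*(((R+k)*tx)^2+((R+k)*ty)^2) := by ring
  rw [e3, e4, htx, hty, hk, hR, hh, hq]
  subst hs hd hS
  field_simp
  ring

lemma aj_core (ax ay bx bY cx cy dx dy ox oy tx ty τ t α β γ α' β' γ' α'' β'' γ'' k R : ℝ)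
    (hk0 : 0 < k) (hR0 : 0 < R)
    (hL0 : 0 = bx + τ*(cx-bx)) (hL1 : 0 = bY + τ*(cy-bY))
    (hbc : (cx-bx)^2+(cy-bY)^2 = ((cx-bx)*(1-bY) - (cy-bY)*(0-bx))^2)
    (hab : (bx-ax)^2+(bY-ay)^2 = ((bx-ax)*(1-ay) - (bY-ay)*(0-ax))^2)
    (hca : (cx-ax)^2+(cy-ay)^2 = ((cx-ax)*(1-ay) - (cy-ay)*(0-ax))^2)
    (hn : (bx-ax)*(cy-ay)-(bY-ay)*(cx-ax) ≠ 0)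
    (hα : 0 ≤ α) (hβ : 0 ≤ β) (hγ : 0 ≤ γ) (hsum : α+β+γ = 1)
    (hI0 : 0 = α*ax+β*bx+γ*cx) (hI1 : 1 = α*ay+β*bY+γ*cy)
    (hβ' : 0 ≤ β') (hγ' : 0 ≤ γ') (hsum' : α'+β'+γ' = 1)
    (hD0 : dx = α'*ax+β'*bx+γ'*cx) (hD1 : dy = α'*ay+β'*bY+γ'*cy)
    (hα'' : 0 ≤ α'')
    (hE1 : dy - k = α''*ay+β''*bY+γ''*cy)
    (hDab : k^2*((bx-ax)^2+(bY-ay)^2) = ((bx-ax)*(dy-ay) - (bY-ay)*(dx-ax))^2)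
    (hDca : k^2*((cx-ax)^2+(cy-ay)^2) = ((cx-ax)*(dy-ay) - (cy-ay)*(dx-ax))^2)
    (hB : (bx-ox)^2+(bY-oy)^2 = R^2) (hC : (cx-ox)^2+(cy-oy)^2 = R^2)
    (hO : (ox-dx)^2+(oy-dy)^2 = (R+k)^2)
    (hT0 : tx = ox + t*(dx-ox)) (hT1 : ty = oy + t*(dy-oy)) (ht : 0 ≤ t)
    (hT : (tx-ox)^2+(ty-oy)^2 = R^2) :
    k < 1 ∧ dx = (1-k)*ax ∧ dy = (1-k)*ay+k ∧ 2 < ay ∧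
    (1-k)^2*((tx-ax)^2+(ty-ay)^2) = k^2*(tx^2+ty^2) := by
  have hyy : (cy-bY)^2 = 0 := by
    have : (cx-bx)*(1-bY) - (cy-bY)*(0-bx) = cx-bx := by
      linear_combination (cx-bx)*hL1 - (cy-bY)*hL0
    rw [this] at hbc; linarith
  have hcb : cy = bY := by have := pow_eq_zero_iff (two_ne_zero) |>.1 hyy; linarith
  have hb0 : bY = 0 := by rw [hcb] at hL1; linarith
  have hc0 : cy = 0 := by rw [hcb, hb0]
  subst hc0 hb0
  have hbc0 : cx - bx ≠ 0 := by
    intro h; apply hn; linear_combination ay*h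
  have hay0 : ay ≠ 0 := by
    intro h; apply hn; rw [h]; ring
  have hαay : α*ay = 1 := by linarith
  have hay : 0 < ay := by
    by_contra h; push Not at h; have := mul_nonpos_of_nonneg_of_nonpos hα h; linarith
  obtain ⟨b, rfl⟩ : ∃ b, bx = -b := ⟨-bx, by ring⟩
  have hA1 : ay*(b^2-1) = 2*b*(ax+b) := by
    apply mul_left_cancel₀ hay0; linear_combination -hab
  have hA2 : ay*(cx^2-1) = 2*cx*(cx-ax) := by
    apply mul_left_cancel₀ hay0; linear_combination -hca
  have hb' : b^2+1 = 2*b*γ*(b+cx) := by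
    apply mul_left_cancel₀ hay0
    linear_combination (-1)*hA1 + 2*b*(ax+b)*hαay + 2*b*ay*hI0 - 2*b^2*ay*hsum
  have hc' : cx^2+1 = 2*cx*β*(b+cx) := by
    apply mul_left_cancel₀ hay0
    linear_combination (-1)*hA2 + 2*cx*(cx-ax)*hαay - 2*cx*ay*hI0 - 2*cx^2*ay*hsum
  have hbpos : 0 < b*(b+cx) := by
    by_contra h; push Not at h
    have h1 := mul_nonneg hγ (neg_nonneg.2 h)
    have h2 : b^2+1 = -2*(γ * -(b*(b+cx))) := by rw [hb']; ring
    have h3 := sq_nonneg b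
    linarith
  have hcpos : 0 < cx*(b+cx) := by
    by_contra h; push Not at h
    have h1 := mul_nonneg hβ (neg_nonneg.2 h)
    have h2 : cx^2+1 = -2*(β * -(cx*(b+cx))) := by rw [hc']; ring
    have h3 := sq_nonneg cx
    linarith
  have hs0 : 0 < b*cx := by
    by_contra h; push Not at h
    have h1 := mul_pos hbpos hcpos
    have h2 := mul_nonneg (neg_nonneg.2 h) (sq_nonneg (b+cx))
    have h3 : b*(b+cx)*(cx*(b+cx)) = -(-(b*cx)*(b+cx)^2) := by ring
    linarith
  have hbc1 : b+cx ≠ 0 := by intro h; apply hbc0; linarith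
  have hS0 : 0 < (b+cx)^2 := by positivity
  have hayq : ay*(b*cx-1) = 2*(b*cx) := by
    apply mul_left_cancel₀ hbc1
    linear_combination cx*hA1 + b*hA2
  have hq0 : 0 < b*cx-1 := by
    by_contra h; push Not at h
    have := mul_nonpos_of_nonneg_of_nonpos hay.le h
    linarith
  have hb0 : b ≠ 0 := by rintro rfl; simp at hs0
  have hc0 : cx ≠ 0 := by rintro rfl; simp at hs0
  have haxq : ax*(b*cx-1) = b-cx := by
    apply mul_left_cancel₀ hb0
    linear_combination (-1/2)*(b*cx-1)*hA1 + (b^2-1)/2*hayq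
  have hay2 : 2 < ay := by
    by_contra h; push Not at h
    have := mul_le_mul_of_nonneg_right h hq0.le
    linarith
  -- D
  have hγk : γ' = k*γ := by
    have hne : ((b+cx)*ay)^2 ≠ 0 := by positivity
    have h1 : (γ'^2 - (k*γ)^2) = 0 := by
      apply mul_left_cancel₀ hne
      have i1 : (-b-ax)*(dy-ay) - (0-ay)*(dx-ax) = γ'*((b+cx)*ay) := by
        rw [hD0, hD1]; linear_combination (-(b+ax)*ay + ay*ax)*hsum'
      have i2 : (-b-ax)*(1-ay) - (0-ay)*(0-ax) = γ*((b+cx)*ay) := by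
        linear_combination (-b-ax)*hI1 + ay*hI0 + (-(b+ax)*ay + ay*ax)*hsum
      rw [i1] at hDab; rw [i2] at hab
      linear_combination -hDab + k^2*hab
    have h2 : γ'^2 = (k*γ)^2 := by linarith
    exact (pow_left_inj₀ hγ' (by positivity) two_ne_zero).1 h2
  have hβk : β' = k*β := by
    have hne : ((b+cx)*ay)^2 ≠ 0 := by positivity
    have h1 : (β'^2 - (k*β)^2) = 0 := by
      apply mul_left_cancel₀ hne
      have i1 : (cx-ax)*(dy-ay) - (0-ay)*(dx-ax) = -β'*((b+cx)*ay) := by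
        rw [hD0, hD1]; linear_combination ((cx-ax)*ay + ay*ax)*hsum'
      have i2 : (cx-ax)*(1-ay) - (0-ay)*(0-ax) = -β*((b+cx)*ay) := by
        linear_combination (cx-ax)*hI1 + ay*hI0 + ((cx-ax)*ay + ay*ax)*hsum
      rw [i1] at hDca; rw [i2] at hca
      linear_combination -hDca + k^2*hca
    have h2 : β'^2 = (k*β)^2 := by linarith
    exact (pow_left_inj₀ hβ' (by positivity) two_ne_zero).1 h2
  have hα'k : α' = 1 - k + k*α := by linear_combination hsum' - hβk - hγk - k*hsum
  have hdx : dx = (1-k)*ax := by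
    rw [hD0, hα'k, hβk, hγk]; linear_combination -k*hI0
  have hdy : dy = (1-k)*ay+k := by
    rw [hD1, hα'k, hβk, hγk]; linear_combination -k*hI1
  -- O
  have hox : ox = -(b-cx)/2 := by
    apply mul_left_cancel₀ hbc1
    linear_combination (hB-hC)/2
  have hRh : R^2 = oy^2 + (b+cx)^2/4 := by
    rw [← hB, hox]; ring
  have hk1 : k ≤ 1 := by
    by_contra h; push Not at h
    have h1 := mul_nonneg hα'' hay.le
    have h2 := mul_pos (sub_pos.2 h) hay
    have h3 : (k-1)*ay = -(dy-k) := by rw [hdy]; ring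
    linarith
  have hk1' : k < 1 := by
    rcases hk1.lt_or_eq with h | h
    · exact h
    · exfalso
      subst h
      have hh : b*cx + 2*(R+oy) = 0 := by
        rw [hdx, hdy, hox] at hO
        linear_combination -hO - hRh
      have : -R < oy := by
        exact (abs_lt.1 (abs_lt_of_sq_lt_sq (by linarith) hR0.le)).1
      linarith
  refine ⟨hk1', hdx, hdy, hay2, ?_⟩
  have haxe : ax = (b-cx)/(b*cx-1) := by field_simp; linarith
  have haye : ay = 2*(b*cx)/(b*cx-1) := by field_simp; linarith
  have hqne : b*cx-1 ≠ 0 := hq0.ne'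
  have hdx' : dx = (1-k)/(b*cx-1)*(b-cx) := by rw [hdx, haxe]; ring
  have hdy' : dy = b*cx*((1-k)/(b*cx-1)) + (1-k)/(b*cx-1) + 1 := by
    rw [hdy, haye]; field_simp; ring
  have hw : 0 < (1-k)/(b*cx-1) := div_pos (by linarith) hq0
  have hkw : k = 1 - (1-k)/(b*cx-1)*(b*cx-1) := by field_simp; ring
  have hRR := aj_alg b cx (b*cx-1) ((1-k)/(b*cx-1)) k R oy (b-cx) (b*cx) ((b+cx)^2) rfl rfl rfl rfl
    hq0 hw hkw hk0 hR0 hRh hS0 (by rw [← hO, hdx', hdy', hox])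
  have htR : t*(R+k) = R := by
    have : (t*(R+k))^2 = R^2 := by
      rw [← hT, hT0, hT1]; linear_combination -t^2*hO
    exact (pow_left_inj₀ (by positivity) hR0.le two_ne_zero).1 this
  rw [haxe, haye]
  apply aj_T b cx (b*cx-1) ((1-k)/(b*cx-1)) k R oy (b-cx) (b*cx) ((b+cx)^2) tx ty rfl rfl rfl rfl
    hq0 hw hkw hk0 hR0 hRR.1 hRR.2
  · rw [← hdx', hT0, ← hox]; linear_combination (dx-ox)*htR
  · rw [← hdy', hT1]; linear_combination (dy-oy)*htR

lemma aj_dist (P Q : Plane) : dist P Q ^ 2 = (P 0 - Q 0)^2 + (P 1 - Q 1)^2 := by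
  rw [EuclideanSpace.dist_eq, Real.sq_sqrt (by positivity)]
  simp [Fin.sum_univ_two, Real.dist_eq, sq_abs]

lemma aj_hull (A B C P : Plane) (h : P ∈ convexHull ℝ ({A, B, C} : Set Plane)) :
    ∃ α β γ : ℝ, 0 ≤ α ∧ 0 ≤ β ∧ 0 ≤ γ ∧ α + β + γ = 1 ∧
      ∀ i, P i = α * A i + β * B i + γ * C i := by
  rw [convexHull_insert (by simp), convexHull_pair] at h
  simp only [convexJoin_singleton_left, Set.mem_iUnion] at h
  obtain ⟨Q, ⟨a, b, ha, hb, hab, rfl⟩, ⟨c, d, hc, hd, hcd, rfl⟩⟩ := h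
  refine ⟨c, d*a, d*b, hc, by positivity, by positivity, by linear_combination hcd + d*hab, ?_⟩
  intro i
  simp
  ring

open AffineSubspace in
lemma aj_line (A B P : Plane) (h : P ∈ affineSpan ℝ ({A, B} : Set Plane)) :
    ∃ t : ℝ, ∀ i, P i = A i + t * (B i - A i) := by
  obtain ⟨t, rfl⟩ := (mem_affineSpan_pair_iff_exists_lineMap_eq).1 h
  refine ⟨t, fun i => ?_⟩
  simp [AffineMap.lineMap_apply]
  ring

lemma aj_inf (A B P : Plane) (d : ℝ)
    (h : Metric.infDist P (affineSpan ℝ ({A, B} : Set Plane) : Set Plane) = d) :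
    d^2 * ((B 0 - A 0)^2 + (B 1 - A 1)^2) =
      ((B 0 - A 0) * (P 1 - A 1) - (B 1 - A 1) * (P 0 - A 0))^2 := by
  rw [← dist_orthogonalProjection_eq_infDist] at h
  obtain ⟨t, ht⟩ := aj_line A B _ (orthogonalProjection_mem (s := affineSpan ℝ ({A, B} : Set Plane)) P)
  have h1 : inner ℝ (B -ᵥ A) (P -ᵥ (orthogonalProjection (affineSpan ℝ ({A, B} : Set Plane)) P : Plane)) = 0 := by
    apply EuclideanGeometry.vsub_orthogonalProjection_mem_direction_orthogonal (affineSpan ℝ ({A, B} : Set Plane)) P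
    exact AffineSubspace.vsub_mem_direction (right_mem_affineSpan_pair ℝ A B) (left_mem_affineSpan_pair ℝ A B)
  have h2 := aj_dist P (orthogonalProjection (affineSpan ℝ ({A, B} : Set Plane)) P : Plane)
  rw [h] at h2
  simp [PiLp.inner_apply, Fin.sum_univ_two] at h1
  rw [ht 0, ht 1] at h1 h2
  rw [h2]
  generalize A 0 = a0, A 1 = a1, B 0 = b0, B 1 = b1, P 0 = p0, P 1 = p1 at *
  have e : ((b0-a0)*(p1-a1) - (b1-a1)*(p0-a0)) = (b0-a0)*(p1-(a1+t*(b1-a1))) - (b1-a1)*(p0-(a0+t*(b0-a0))) := by ring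
  rw [e]
  have e2 : (b0-a0)*(p0-(a0+t*(b0-a0))) + (b1-a1)*(p1-(a1+t*(b1-a1))) = 0 := by linarith
  linear_combination ((b0-a0)*(p0-(a0+t*(b0-a0))) + (b1-a1)*(p1-(a1+t*(b1-a1)))) * e2

lemma aj_noncol (A B C : Plane) (h : AffineIndependent ℝ ![A, B, C]) :
    (B 0 - A 0) * (C 1 - A 1) - (B 1 - A 1) * (C 0 - A 0) ≠ 0 := by
  intro h0
  rw [affineIndependent_iff_not_collinear_set] at h
  apply h
  rw [collinear_iff_of_mem (p₀ := A) (by simp)]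
  by_cases hB : B = A
  · refine ⟨C - A, ?_⟩
    subst hB
    simp only [Set.mem_insert_iff, Set.mem_singleton_iff]
    rintro p (rfl | rfl | rfl)
    · exact ⟨0, by simp⟩
    · exact ⟨0, by simp⟩
    · exact ⟨1, by simp⟩
  · refine ⟨B - A, ?_⟩
    have hne : (B 0 - A 0)^2 + (B 1 - A 1)^2 ≠ 0 := by
      rw [← aj_dist]; have := dist_pos.2 hB; positivity
    simp only [Set.mem_insert_iff, Set.mem_singleton_iff]
    rintro p (rfl | rfl | rfl)
    · exact ⟨0, by simp⟩
    · exact ⟨1, by simp⟩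
    · refine ⟨((B 0 - A 0)*(p 0 - A 0) + (B 1 - A 1)*(p 1 - A 1))/((B 0 - A 0)^2 + (B 1 - A 1)^2), ?_⟩
      ext i
      fin_cases i
      · simp
        field_simp
        linear_combination (-(B 1 - A 1)) * h0
      · simp
        field_simp
        linear_combination (B 0 - A 0) * h0

lemma aj_angle (A T L L' : Plane) (k : ℝ) (hk0 : 0 < k) (hk1 : k < 1)
    (hL : L' = A + k • (L - A)) (h : (1-k)^2 * dist T A ^2 = k^2 * dist T L^2) :
    ∠ A T L' = ∠ L' T L := by
  have h' : (1-k) * dist T A = k * dist T L := by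
    apply (pow_left_inj₀ (by have := dist_nonneg (x := T) (y := A); nlinarith) (by positivity) two_ne_zero).1
    linear_combination h
  rw [EuclideanGeometry.angle_comm L' T L]
  unfold EuclideanGeometry.angle InnerProductGeometry.angle
  rw [dist_comm T A, dist_comm T L, dist_eq_norm, dist_eq_norm] at h'
  simp only [vsub_eq_sub]
  have e : L' - T = (1-k) • (A - T) + k • (L - T) := by rw [hL]; module
  congr 1
  generalize L' - T = m at *
  generalize A - T = a at *
  generalize L - T = l at *
  rw [div_mul_eq_div_div, div_mul_eq_div_div]
  congr 1
  rw [e, inner_add_right, inner_add_right, inner_smul_right, inner_smul_right, inner_smul_right,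
    inner_smul_right, real_inner_self_eq_norm_sq, real_inner_self_eq_norm_sq, real_inner_comm a l]
  by_cases ha : ‖a‖ = 0
  · have : ‖l‖ = 0 := by
      rw [ha] at h'; simpa [hk0.ne'] using h'.symm
    simp [ha, this]
  · have hl : ‖l‖ ≠ 0 := by
      intro hl; rw [hl] at h'; apply ha
      have : (1-k) ≠ 0 := by linarith
      simpa [this] using h'
    field_simp
    generalize (inner ℝ a l : ℝ) = z
    linear_combination (‖a‖*‖l‖ - z) * h'

noncomputable def ajx (I L : Plane) (r : ℝ) (P : Plane) : ℝ :=
  ((P 0 - L 0)*(I 1 - L 1) - (P 1 - L 1)*(I 0 - L 0))/r^2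

noncomputable def ajy (I L : Plane) (r : ℝ) (P : Plane) : ℝ :=
  ((P 0 - L 0)*(I 0 - L 0) + (P 1 - L 1)*(I 1 - L 1))/r^2

lemma aj_rep (I L : Plane) (r : ℝ) (hr : 0 < r) (h : dist I L = r) (P : Plane) :
    P 0 = L 0 + ajx I L r P * (I 1 - L 1) + ajy I L r P * (I 0 - L 0) ∧
    P 1 = L 1 - ajx I L r P * (I 0 - L 0) + ajy I L r P * (I 1 - L 1) := by
  have h2 := aj_dist I L
  rw [h] at h2
  unfold ajx ajy
  constructor
  · field_simp
    linear_combination (P 0 - L 0) * h2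
  · field_simp
    linear_combination (P 1 - L 1) * h2

lemma aj_fdist (I L : Plane) (r : ℝ) (hr : 0 < r) (h : dist I L = r) (P Q : Plane) :
    dist P Q ^ 2 = r^2*((ajx I L r P - ajx I L r Q)^2 + (ajy I L r P - ajy I L r Q)^2) := by
  rw [aj_dist, (aj_rep I L r hr h P).1, (aj_rep I L r hr h P).2, (aj_rep I L r hr h Q).1,
    (aj_rep I L r hr h Q).2, ← h, aj_dist I L]
  ring

lemma aj_fdist' (I L : Plane) (r : ℝ) (hr : 0 < r) (h : dist I L = r) (P Q : Plane) (k : ℝ)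
    (hd : dist P Q = k * r) :
    (ajx I L r P - ajx I L r Q)^2 + (ajy I L r P - ajy I L r Q)^2 = k^2 := by
  have := aj_fdist I L r hr h P Q
  rw [hd] at this
  have hr2 : r^2 ≠ 0 := by positivity
  apply mul_left_cancel₀ hr2
  linear_combination -this

lemma aj_finf (I L : Plane) (r : ℝ) (hr : 0 < r) (h : dist I L = r) (A B P : Plane) (k : ℝ)
    (hd : Metric.infDist P (affineSpan ℝ ({A, B} : Set Plane) : Set Plane) = k * r) :
    k^2 * ((ajx I L r B - ajx I L r A)^2 + (ajy I L r B - ajy I L r A)^2) =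
      ((ajx I L r B - ajx I L r A) * (ajy I L r P - ajy I L r A)
        - (ajy I L r B - ajy I L r A) * (ajx I L r P - ajx I L r A))^2 := by
  have h1 := aj_inf A B P _ hd
  have h2 := aj_dist I L
  rw [h] at h2
  rw [(aj_rep I L r hr h P).1, (aj_rep I L r hr h P).2, (aj_rep I L r hr h A).1,
    (aj_rep I L r hr h A).2, (aj_rep I L r hr h B).1, (aj_rep I L r hr h B).2] at h1
  generalize ajx I L r A = ax, ajy I L r A = ay, ajx I L r B = bx, ajy I L r B = bY,
    ajx I L r P = px, ajy I L r P = py at *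
  generalize I 0 - L 0 = s, I 1 - L 1 = u at *
  have hr2 : (r^2)^2 ≠ 0 := by positivity
  apply mul_left_cancel₀ hr2
  have h3 : k^2*r^2*((s^2+u^2)*((bx-ax)^2+(bY-ay)^2)) =
    ((s^2+u^2)*((bx-ax)*(py-ay)-(bY-ay)*(px-ax)))^2 := by linear_combination h1
  rw [← h2] at h3
  linear_combination h3

lemma aj_fcomb (I L : Plane) (r : ℝ) (A B C P : Plane) (α β γ : ℝ)
    (hs : α + β + γ = 1) (h : ∀ i, P i = α * A i + β * B i + γ * C i) :
    ajx I L r P = α * ajx I L r A + β * ajx I L r B + γ * ajx I L r C ∧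
    ajy I L r P = α * ajy I L r A + β * ajy I L r B + γ * ajy I L r C := by
  unfold ajx ajy
  rw [h 0, h 1]
  constructor
  · linear_combination (L 0 * (I 1 - L 1) - L 1 * (I 0 - L 0))/r^2 * hs
  · linear_combination (L 0 * (I 0 - L 0) + L 1 * (I 1 - L 1))/r^2 * hs

lemma aj_fline (I L : Plane) (r : ℝ) (A B P : Plane) (t : ℝ)
    (h : ∀ i, P i = A i + t * (B i - A i)) :
    ajx I L r P = ajx I L r A + t * (ajx I L r B - ajx I L r A) ∧
    ajy I L r P = ajy I L r A + t * (ajy I L r B - ajy I L r A) := by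
  unfold ajx ajy
  rw [h 0, h 1]
  constructor <;> ring

lemma aj_fnoncol (I L : Plane) (r : ℝ) (hr : 0 < r) (h : dist I L = r) (A B C : Plane)
    (hn : AffineIndependent ℝ ![A, B, C]) :
    (ajx I L r B - ajx I L r A) * (ajy I L r C - ajy I L r A)
      - (ajy I L r B - ajy I L r A) * (ajx I L r C - ajx I L r A) ≠ 0 := by
  intro h0
  apply aj_noncol A B C hn
  rw [(aj_rep I L r hr h C).1, (aj_rep I L r hr h C).2, (aj_rep I L r hr h A).1,
    (aj_rep I L r hr h A).2, (aj_rep I L r hr h B).1, (aj_rep I L r hr h B).2]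
  linear_combination ((I 0 - L 0)^2 + (I 1 - L 1)^2) * h0

lemma aj_root (ax ay k t s : ℝ) (hay : 2 < ay) (hk : 0 < k)
    (ht : ((1-k)*ax - (1-t)*ax)^2 + ((1-k)*ay + k - (1-t)*ay)^2 = k^2)
    (hs : ((1-k)*ax - (1-s)*ax)^2 + ((1-k)*ay + k - (1-s)*ay)^2 = k^2)
    (hlt : s^2 < t^2) : t = k := by
  have hN : 0 < (ax^2+ay^2) := by positivity
  have hN2 : 0 < ax^2+ay^2 - 2*ay := by nlinarith [sq_nonneg ax]
  have ht' : (t-k)*((t-k)*(ax^2+ay^2)+2*k*ay) = 0 := by linear_combination ht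
  have hs' : (s-k)*((s-k)*(ax^2+ay^2)+2*k*ay) = 0 := by linear_combination hs
  rcases mul_eq_zero.1 ht' with h | h
  · linarith
  exfalso
  rcases mul_eq_zero.1 hs' with h' | h'
  · have hsk : s = k := by linarith
    have h1 : t*(ax^2+ay^2) = k*(ax^2+ay^2-2*ay) := by linear_combination h
    have h2 : 0 < t := by
      have := mul_pos hk hN2
      rw [← h1] at this
      exact (mul_pos_iff_of_pos_right hN).1 this
    have h3 : t < k := by
      by_contra h4; push Not at h4
      have h5 := mul_le_mul_of_nonneg_right h4 hN.le
      have h6 : 0 < k*ay := by positivity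
      linarith
    rw [hsk] at hlt
    have := pow_lt_pow_left₀ h3 h2.le two_ne_zero
    linarith
  · have h1 : (s-t)*(ax^2+ay^2) = 0 := by linear_combination h' - h
    rcases mul_eq_zero.1 h1 with h2 | h2
    · have : s = t := by linarith
      rw [this] at hlt; exact lt_irrefl _ hlt
    · exact hN.ne' h2

/-- In the Ajima-circle configuration, let `L` be the touch point of the incircle
with `BC` and let `L'`, `X` be the intersection points of line `AL` with `γ`, with
`L'` closer to `L` and `X` closer to `A`.  Then `TL'` bisects `∠ A T L`:
`∠ A T L' = ∠ L' T L`. -/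
theorem TL'_bisects_ATL
    (A B C I Oω D T : Plane) (r Rω ρ : ℝ)
    (hABC : AffineIndependent ℝ ![A, B, C])
    (hr : 0 < r)
    (hIin : I ∈ interior (convexHull ℝ ({A, B, C} : Set Plane)))
    (hIab : Metric.infDist I (affineSpan ℝ ({A, B} : Set Plane) : Set Plane) = r)
    (hIbc : Metric.infDist I (affineSpan ℝ ({B, C} : Set Plane) : Set Plane) = r)
    (hIca : Metric.infDist I (affineSpan ℝ ({C, A} : Set Plane) : Set Plane) = r)
    (hRω : 0 < Rω) (hρ : 0 < ρ)
    (hBω : dist B Oω = Rω) (hCω : dist C Oω = Rω)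
    (hγin : Metric.sphere D ρ ⊆ convexHull ℝ ({A, B, C} : Set Plane))
    (hγAB : Metric.infDist D (affineSpan ℝ ({A, B} : Set Plane) : Set Plane) = ρ)
    (hγAC : Metric.infDist D (affineSpan ℝ ({A, C} : Set Plane) : Set Plane) = ρ)
    (hext : dist Oω D = Rω + ρ)
    (hTω : dist T Oω = Rω) (hTγ : dist T D = ρ)
    (hTseg : Wbtw ℝ Oω T D)
    (hTin : T ∈ interior (convexHull ℝ ({A, B, C} : Set Plane)))
    (L L' X : Plane)
    (hL : L ∈ affineSpan ℝ ({B, C} : Set Plane)) (hLI : dist I L = r)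
    (hL' : L' ∈ affineSpan ℝ ({A, L} : Set Plane)) (hL'γ : dist D L' = ρ)
    (hX : X ∈ affineSpan ℝ ({A, L} : Set Plane)) (hXγ : dist D X = ρ)
    (hXL' : X ≠ L') (hXcloser : dist A X < dist A L') :
    ∠ A T L' = ∠ L' T L := by

  obtain ⟨k, hk⟩ : ∃ k, ρ = k * r := ⟨ρ / r, by field_simp⟩
  obtain ⟨R, hR⟩ : ∃ R, Rω = R * r := ⟨Rω / r, by field_simp⟩
  have hk0 : 0 < k := by rw [hk] at hρ; exact (mul_pos_iff_of_pos_right hr).1 hρ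
  have hR0 : 0 < R := by rw [hR] at hRω; exact (mul_pos_iff_of_pos_right hr).1 hRω
  have hrr : r ≠ 0 := hr.ne'
  have hI2 := aj_dist I L
  rw [hLI] at hI2
  have hLx : ajx I L r L = 0 := by simp [ajx]
  have hLy : ajy I L r L = 0 := by simp [ajy]
  have hIx : ajx I L r I = 0 := by simp [ajx]; left; ring
  have hIy : ajy I L r I = 1 := by
    unfold ajy; field_simp; linear_combination -hI2
  obtain ⟨τ, hτ⟩ := aj_line _ _ _ hL
  obtain ⟨α, β, γ, hα, hβ, hγ, hsum, hI⟩ := aj_hull _ _ _ _ (interior_subset hIin)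
  -- center of the circle in hull
  let v : Plane := I - L
  have hv : ‖v‖ = r := by rw [← hLI, dist_eq_norm]
  have hkv : ‖k • v‖ = ρ := by rw [norm_smul, hv, hk, Real.norm_of_nonneg hk0.le]
  have hm1 : D - k • v ∈ convexHull ℝ ({A, B, C} : Set Plane) := by
    apply hγin; simp [hkv]
  have hm2 : D + k • v ∈ convexHull ℝ ({A, B, C} : Set Plane) := by
    apply hγin; simp [hkv]
  have hm : D ∈ convexHull ℝ ({A, B, C} : Set Plane) := by
    have := (convex_convexHull ℝ ({A, B, C} : Set Plane)) hm1 hm2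
      (by norm_num : (0:ℝ) ≤ 1/2) (by norm_num : (0:ℝ) ≤ 1/2) (by norm_num)
    convert this using 1
    module
  obtain ⟨α', β', γ', hα', hβ', hγ', hsum', hD⟩ := aj_hull _ _ _ _ hm
  obtain ⟨α'', β'', γ'', hα'', hβ'', hγ'', hsum'', hE⟩ := aj_hull _ _ _ _ hm1
  have hEy : ajy I L r (D - k • v) = ajy I L r D - k := by
    simp only [ajy, v, PiLp.sub_apply, PiLp.smul_apply, smul_eq_mul]
    field_simp
    linear_combination k * hI2
  obtain ⟨t, ht, hT⟩ := hTseg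
  have hT' : ∀ i, T i = Oω i + t * (D i - Oω i) := by
    intro i; rw [← hT]; simp [AffineMap.lineMap_apply]; ring
  have cL := aj_fline I L r _ _ _ _ hτ
  have cI := aj_fcomb I L r _ _ _ _ _ _ _ hsum hI
  have cD := aj_fcomb I L r _ _ _ _ _ _ _ hsum' hD
  have cE := aj_fcomb I L r _ _ _ _ _ _ _ hsum'' hE
  have cT := aj_fline I L r _ _ _ _ hT'
  have iab := aj_finf I L r hr hLI A B I 1 (by rw [hIab, one_mul])
  have ibc := aj_finf I L r hr hLI B C I 1 (by rw [hIbc, one_mul])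
  have ica := aj_finf I L r hr hLI A C I 1 (by rw [Set.pair_comm, hIca, one_mul])
  have dab := aj_finf I L r hr hLI A B D k (by rw [hγAB, hk])
  have dca := aj_finf I L r hr hLI A C D k (by rw [hγAC, hk])
  have dB := aj_fdist' I L r hr hLI B Oω R (by rw [hBω, hR])
  have dC := aj_fdist' I L r hr hLI C Oω R (by rw [hCω, hR])
  have dT := aj_fdist' I L r hr hLI T Oω R (by rw [hTω, hR])
  have dO := aj_fdist' I L r hr hLI Oω D (R+k) (by rw [hext, hR, hk]; ring)
  have dL' := aj_fdist' I L r hr hLI D L' k (by rw [hL'γ, hk])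
  have dX := aj_fdist' I L r hr hLI D X k (by rw [hXγ, hk])
  rw [hLx, hLy] at cL
  rw [hIx, hIy] at cI iab ibc ica
  rw [one_pow, one_mul] at iab ibc ica
  obtain ⟨hk1, hdx, hdy, hay, hfin⟩ := aj_core _ _ _ _ _ _ _ _ _ _ _ _ τ t α β γ α' β' γ' α'' β'' γ'' k R
    hk0 hR0 cL.1 cL.2 ibc iab ica (aj_fnoncol I L r hr hLI A B C hABC) hα hβ hγ hsum cI.1 cI.2
    hβ' hγ' hsum' cD.1 cD.2 hα'' (by rw [← hEy]; exact cE.2) dab dca dB dC dO cT.1 cT.2 ht.1 dT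
  obtain ⟨a, ha⟩ := aj_line _ _ _ hL'
  obtain ⟨s, hs⟩ := aj_line _ _ _ hX
  have cL' := aj_fline I L r _ _ _ _ ha
  have cX := aj_fline I L r _ _ _ _ hs
  have hN : 0 < (A 0 - L 0)^2 + (A 1 - L 1)^2 := by
    rw [← aj_dist]
    have : A ≠ L := by
      rintro h; rw [h, hLy] at hay; linarith
    have := dist_pos.2 this
    positivity
  have hlt : s^2 < a^2 := by
    have h1 := pow_lt_pow_left₀ hXcloser dist_nonneg two_ne_zero
    rw [aj_dist, aj_dist, hs 0, hs 1, ha 0, ha 1] at h1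
    have h2 : s^2*((A 0 - L 0)^2 + (A 1 - L 1)^2) < a^2*((A 0 - L 0)^2 + (A 1 - L 1)^2) := by
      linarith
    exact lt_of_mul_lt_mul_right h2 hN.le
  rw [cL'.1, cL'.2, hdx, hdy, hLx, hLy] at dL'
  rw [cX.1, cX.2, hdx, hdy, hLx, hLy] at dX
  have hak : a = k := aj_root (ajx I L r A) (ajy I L r A) k a s hay hk0 (by linear_combination dL') (by linear_combination dX) hlt
  subst hak
  apply aj_angle A T L L' a hk0 hk1
  · ext i
    simp [ha i]
  · rw [aj_fdist I L r hr hLI, aj_fdist I L r hr hLI, hLx, hLy]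
    linear_combination r^2 * hfin
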